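/- The word d11 (the three-letter word with letters d, 1, 1) is the unique word of length 3 in L(Ω) having 11 as a suffix. -/

import Mathlib

/-- The substitution σ on the alphabet A = {1, …, d}:
σ(1) = 12, σ(k) = k+1 for 2 ≤ k ≤ d−1, σ(d) = 1. Letters are literal natural numbers. -/
def sig (d : ℕ) (a : ℕ) : List ℕ :=
  if a = 1 then [1, 2] else if a = d then [1] else [a + 1]

/-- Extension of a substitution to finite words by concatenation. -/
def applySub (f : ℕ → List ℕ) : List ℕ → List ℕ
  | [] => []
  | a :: w => f a ++ applySub f w

/-- σⁿ applied to a word. -/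
def sigIter (d n : ℕ) (w : List ℕ) : List ℕ := (applySub (sig d))^[n] w

/-- The language L(Ω): the set of finite factors of the fixed point ω, i.e. of the
words σⁿ(1). -/
def Lang (d : ℕ) (u : List ℕ) : Prop := ∃ n : ℕ, u <:+: sigIter d n [1]

/-- `w` is a (finite) prefix of the infinite word `V`. -/
def PrefixOfInf (w : List ℕ) (V : ℕ → ℕ) : Prop :=
  ∀ (i : ℕ) (h : i < w.length), w.get ⟨i, h⟩ = V i

/-- `ω` is the fixed point of σ: the unique infinite word admitting every σⁿ(1) as a
prefix. -/
def IsSigmaFixedPoint (d : ℕ) (ω : ℕ → ℕ) : Prop :=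
  ∀ n : ℕ, PrefixOfInf (sigIter d n [1]) ω

/-- `u` is left-special: there are distinct letters a, b ∈ A with au, bu ∈ L(Ω). -/
def LeftSpecial (d : ℕ) (u : List ℕ) : Prop :=
  ∃ a b : ℕ, a ≠ b ∧ 1 ≤ a ∧ a ≤ d ∧ 1 ≤ b ∧ b ≤ d ∧
    Lang d (a :: u) ∧ Lang d (b :: u)

/-- `u` is right-special: there are distinct letters a, b ∈ A with ua, ub ∈ L(Ω). -/
def RightSpecial (d : ℕ) (u : List ℕ) : Prop :=
  ∃ a b : ℕ, a ≠ b ∧ 1 ≤ a ∧ a ≤ d ∧ 1 ≤ b ∧ b ≤ d ∧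
    Lang d (u ++ [a]) ∧ Lang d (u ++ [b])

/-- `u` is bispecial: both left- and right-special. -/
def Bispecial (d : ℕ) (u : List ℕ) : Prop := LeftSpecial d u ∧ RightSpecial d u

/-- The shift S on infinite words. -/
def shiftMap (V : ℕ → ℕ) : ℕ → ℕ := fun i => V (i + 1)

/-- Ω⁺ : the closure (for the product topology, letters discrete) of the shift
orbit of ω. -/
def OmegaPlus (ω : ℕ → ℕ) : Set (ℕ → ℕ) :=
  closure {V : ℕ → ℕ | ∃ n : ℕ, V = shiftMap^[n] ω}

/-- The cylinder C_u = {V ∈ Ω⁺ : u is a prefix of V}. -/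
def Cyl (ω : ℕ → ℕ) (u : List ℕ) : Set (ℕ → ℕ) :=
  {V | V ∈ OmegaPlus ω ∧ PrefixOfInf u V}

/-- Prepending a letter to an infinite word. -/
def consInf (a : ℕ) (V : ℕ → ℕ) : ℕ → ℕ :=
  fun i => match i with
  | 0 => a
  | j + 1 => V j

/-- Extension of σ to infinite words: σ(V) = σ(V₀)σ(V₁)σ(V₂)⋯ (each σ(a) is a
nonempty word, so the n-th letter of σ(V) is the n-th letter of σ(V₀…Vₙ)). -/
def sigInf (d : ℕ) (V : ℕ → ℕ) : ℕ → ℕ :=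
  fun n => (applySub (sig d) ((List.range (n + 1)).map V)).getD n 0

/-- Concatenation of a finite list of words. -/
def concatAll : List (List ℕ) → List ℕ
  | [] => []
  | w :: ws => w ++ concatAll ws

theorem applySub_append (f : ℕ → List ℕ) (u v : List ℕ) :
    applySub f (u ++ v) = applySub f u ++ applySub f v := by
  induction u with
  | nil => rfl
  | cons a u ih => simp [applySub, ih]

theorem Lang.of_infix {d : ℕ} {u v : List ℕ} (hv : Lang d v) (h : u <:+: v) : Lang d u := by
  obtain ⟨n, hn⟩ := hv
  exact ⟨n, h.trans hn⟩

theorem sigIter_succ (d n : ℕ) (w : List ℕ) :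
    sigIter d (n + 1) w = applySub (sig d) (sigIter d n w) := by
  simp only [sigIter, Function.iterate_succ_apply']

theorem Lang.applySub {d : ℕ} {u : List ℕ} (hu : Lang d u) :
    Lang d (applySub (sig d) u) := by
  obtain ⟨n, s, t, h⟩ := hu
  refine ⟨n + 1, _root_.applySub (sig d) s, _root_.applySub (sig d) t, ?_⟩
  rw [sigIter_succ, ← h, applySub_append, applySub_append]

theorem sig_one (d : ℕ) : sig d 1 = [1, 2] := by simp [sig]

theorem sig_last {d : ℕ} (hd : 3 ≤ d) : sig d d = [1] := by
  simp [sig, show d ≠ 1 by lia]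

theorem sig_of_ne {d a : ℕ} (h1 : a ≠ 1) (hd : a ≠ d) : sig d a = [a + 1] := by
  simp [sig, h1, hd]

/-- Three consecutive increasing letters form a word of the language. -/
theorem lang_three_consecutive {d : ℕ} (k : ℕ) (hk : k + 3 ≤ d) :
    Lang d [k + 1, k + 2, k + 3] := by
  induction k with
  | zero =>
    refine ⟨2, ?_⟩
    simp [sigIter, applySub, sig_one, sig_of_ne (d := d) (a := 2) (by lia) (by lia)]
  | succ k ih =>
    refine (ih (by lia)).applySub.of_infix ?_
    simp only [applySub, sig_of_ne (d := d) (a := k + 2) (by lia) (by lia),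
      sig_of_ne (d := d) (a := k + 3) (by lia) (by lia)]
    by_cases hk0 : k = 0
    · subst hk0
      exact ⟨[1], [], by simp [sig_one]⟩
    · rw [sig_of_ne (by lia) (by lia)]
      exact ⟨[], [], by simp⟩

theorem lang_last_one_one {d : ℕ} (hd : 3 ≤ d) : Lang d [d, 1, 1] := by
  obtain ⟨k, rfl⟩ := Nat.exists_eq_add_of_le' hd
  have h : Lang (k + 3) [k + 2, k + 3, 1] := by
    refine (lang_three_consecutive k le_rfl).applySub.of_infix ?_
    simp only [applySub, sig_of_ne (d := k + 3) (a := k + 2) (by lia) (by lia), sig_last hd]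
    by_cases hk0 : k = 0
    · subst hk0
      exact ⟨[1], [], by simp [sig_one]⟩
    · rw [sig_of_ne (by lia) (by lia)]
      exact ⟨[], [], by simp⟩
  refine h.applySub.of_infix ?_
  simp only [applySub, sig_of_ne (d := k + 3) (a := k + 2) (by lia) (by lia), sig_last hd, sig_one]
  exact ⟨[], [2], by simp⟩

/-- Every letter is at most `d` and is followed by its successor or by `1`. -/
def SuccOrOne (d : ℕ) : List ℕ → Prop
  | [] => True
  | [a] => a ≤ d
  | a :: b :: w => a ≤ d ∧ (b = a + 1 ∨ b = 1) ∧ SuccOrOne d (b :: w)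

theorem SuccOrOne.tail {d a : ℕ} {w : List ℕ} (h : SuccOrOne d (a :: w)) : SuccOrOne d w := by
  cases w with
  | nil => trivial
  | cons b w => exact h.2.2

theorem SuccOrOne.head_le {d a : ℕ} {w : List ℕ} (h : SuccOrOne d (a :: w)) : a ≤ d := by
  cases w with
  | nil => exact h
  | cons b w => exact h.1

theorem SuccOrOne.applySub {d : ℕ} (hd : 3 ≤ d) {w : List ℕ} (h : SuccOrOne d w) :
    SuccOrOne d (applySub (sig d) w) := by
  induction w with
  | nil => trivial
  | cons a w ih =>
    have ih := ih h.tail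
    have ha := h.head_le
    cases w with
    | nil =>
      rcases eq_or_ne a 1 with rfl | h1
      · simp [_root_.applySub, sig_one, SuccOrOne]; lia
      · rcases eq_or_ne a d with rfl | h2
        · simp [_root_.applySub, sig_last hd, SuccOrOne]; lia
        · simp [_root_.applySub, sig_of_ne h1 h2, SuccOrOne]; lia
    | cons b w =>
      have hab := h.2.1
      have hb := h.tail.head_le
      simp only [_root_.applySub] at ih ⊢
      simp only [sig] at ih ⊢
      split_ifs at ih ⊢ <;> simp_all [SuccOrOne] <;> lia

theorem not_one_one_prefix_applySub {d b : ℕ} {w : List ℕ} (hb : b ≠ d) (hb0 : b ≠ 0) :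
    ¬ [1, 1] <+: applySub (sig d) (b :: w) := by
  rcases eq_or_ne b 1 with rfl | h1
  · simp [applySub, sig_one]
  · simp [applySub, sig_of_ne h1 hb, hb0]

theorem eq_last_of_infix_applySub {d c : ℕ} (hd : 3 ≤ d) {w : List ℕ} (h : SuccOrOne d w)
    (hc : [c, 1, 1] <:+: applySub (sig d) w) : c = d := by
  induction w with
  | nil => simp [applySub] at hc
  | cons a w ih =>
    have ih := ih h.tail
    have key : ∀ e, [c, 1, 1] <+: e :: applySub (sig d) w → c = e ∧ a + 1 = d := by
      intro e he
      rw [List.cons_prefix_cons] at he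
      refine ⟨he.1, ?_⟩
      cases w with
      | nil => simp [applySub] at he
      | cons b w =>
        by_contra hne
        have hb := h.tail.head_le
        have ha := h.head_le
        rcases h.2.1 with rfl | rfl
        · exact not_one_one_prefix_applySub (by lia) (by lia) he.2
        · exact not_one_one_prefix_applySub (by lia) (by lia) he.2
    rw [applySub] at hc
    rcases eq_or_ne a 1 with rfl | h1
    · simp only [sig_one, List.cons_append, List.nil_append] at hc
      rcases List.infix_cons_iff.1 hc with hc | hc
      · simp at hc
      · rcases List.infix_cons_iff.1 hc with hc | hc
        · have := key 2 hc
          lia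
        · exact ih hc
    · rcases eq_or_ne a d with rfl | h2
      · simp only [sig_last hd, List.cons_append, List.nil_append] at hc
        rcases List.infix_cons_iff.1 hc with hc | hc
        · have := key 1 hc
          lia
        · exact ih hc
      · simp only [sig_of_ne h1 h2, List.cons_append, List.nil_append] at hc
        rcases List.infix_cons_iff.1 hc with hc | hc
        · have := key _ hc
          lia
        · exact ih hc

theorem succOrOne_sigIter {d : ℕ} (hd : 3 ≤ d) (n : ℕ) : SuccOrOne d (sigIter d n [1]) := by
  induction n with
  | zero => exact (by lia : 1 ≤ d)
  | succ n ih =>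
    rw [sigIter_succ]
    exact ih.applySub hd

theorem Lang.eq_last_of_one_one {d c : ℕ} (hd : 3 ≤ d) (h : Lang d [c, 1, 1]) : c = d := by
  obtain ⟨n, hn⟩ := h
  cases n with
  | zero => simpa [sigIter] using hn.length_le
  | succ n =>
    rw [sigIter_succ] at hn
    exact eq_last_of_infix_applySub hd (succOrOne_sigIter hd n) hn

/-- d11 is the unique word of length 3 in L(Ω) having 11 as a suffix. -/
theorem stmt_18 (d : ℕ) (hd : 3 ≤ d) :
    Lang d [d, 1, 1] ∧
    ∀ u : List ℕ, Lang d u → u.length = 3 → [1, 1] <:+ u → u = [d, 1, 1] := by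
  refine ⟨lang_last_one_one hd, ?_⟩
  rintro u hu hlen ⟨s, rfl⟩
  obtain ⟨c, rfl⟩ := List.length_eq_one_iff.1 (show s.length = 1 by simpa using hlen)
  rw [Lang.eq_last_of_one_one hd hu]
  rfl
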